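/- Let p be prime, λ_d an element of multiplicative order t modulo p, and let T be the number of 5-tuples (x1, x2, x3, x4, y) with 1 ≤ x1, x2, x3, x4, y ≤ t satisfying both λ_d^{x1} + λ_d^{x2} ≡ λ_d^{x3} + λ_d^{x4} (mod p) and λ_d^{x1 y} + λ_d^{x2 y} ≡ λ_d^{x3 y} + λ_d^{x4 y} (mod p). Then T ≪ t^{14/3} p^{-1} + t^{7/2} (the stated bound in the paper is T ≪ t^{14/3} p^{-1}). -/

import Mathlib

theorem aux_poly {F : Type*} [Field F] (e1 e2 e3 e4 N : ℕ) (c1 c2 c3 c4 : F)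
    (h1 : c1 ≠ 0) (h2 : c2 ≠ 0) (h3 : c3 ≠ 0) (h4 : c4 ≠ 0)
    (l1 : e1 ≤ N) (l2 : e2 ≤ N) (l3 : e3 ≤ N) (l4 : e4 ≤ N)
    (ha : ¬ (e1 = e3 ∧ e2 = e4)) (hb : ¬ (e1 = e4 ∧ e2 = e3)) (hc : ¬ (e1 = e2 ∧ e3 = e4))
    (S : Finset F) (hS : ∀ w ∈ S, c1 * w ^ e1 + c2 * w ^ e2 = c3 * w ^ e3 + c4 * w ^ e4) :
    S.card ≤ N := by
  classical
  set P : Polynomial F := Polynomial.C c1 * Polynomial.X ^ e1 + Polynomial.C c2 * Polynomial.X ^ e2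
    - Polynomial.C c3 * Polynomial.X ^ e3 - Polynomial.C c4 * Polynomial.X ^ e4 with hP
  have hP0 : P ≠ 0 := by
    intro h0
    have key : ∀ e, (if e = e1 then c1 else 0) + (if e = e2 then c2 else 0)
        - (if e = e3 then c3 else 0) - (if e = e4 then c4 else 0) = 0 := by
      intro e
      have := congrArg (fun q => Polynomial.coeff q e) h0
      simpa [hP, Polynomial.coeff_X_pow] using this
    have k1 := key e1
    have k2 := key e2
    have k3 := key e3
    have k4 := key e4
    by_cases h12 : e1 = e2
    · by_cases h13 : e1 = e3
      · by_cases h14 : e1 = e4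
        · omega
        · subst h12 h13
          simp [Ne.symm h14] at k4
          exact h4 k4
      · by_cases h14 : e1 = e4
        · subst h12 h14
          simp [Ne.symm h13] at k3
          exact h3 k3
        · by_cases h34 : e3 = e4
          · omega
          · subst h12
            simp [Ne.symm h13, h34] at k3
            exact h3 k3
    · by_cases h13 : e1 = e3
      · by_cases h24 : e2 = e4
        · omega
        · subst h13
          simp [Ne.symm h12, h24] at k2
          exact h2 k2
      · by_cases h14 : e1 = e4
        · by_cases h23 : e2 = e3
          · omega
          · subst h14
            simp [Ne.symm h12, h23] at k2
            exact h2 k2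
        · simp [h12, h13, h14] at k1
          exact h1 k1
  have hdeg : P.natDegree ≤ N := by
    have aux : ∀ (c : F) e, e ≤ N → (Polynomial.C c * Polynomial.X ^ e).natDegree ≤ N :=
      fun c e he => (Polynomial.natDegree_C_mul_X_pow_le c e).trans he
    refine (Polynomial.natDegree_sub_le_of_le (Polynomial.natDegree_sub_le_of_le
      (Polynomial.natDegree_add_le_of_degree_le (aux _ _ l1) (aux _ _ l2)) (aux _ _ l3)) (aux _ _ l4)).trans ?_
    simp
  have hsub : S ⊆ P.roots.toFinset := by
    intro w hw
    rw [Multiset.mem_toFinset, Polynomial.mem_roots hP0]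
    have := hS w hw
    simp only [Polynomial.IsRoot, hP, Polynomial.eval_sub, Polynomial.eval_add, Polynomial.eval_mul,
      Polynomial.eval_C, Polynomial.eval_pow, Polynomial.eval_X]
    linear_combination this
  calc S.card ≤ P.roots.toFinset.card := Finset.card_le_card hsub
    _ ≤ Multiset.card P.roots := Multiset.toFinset_card_le _
    _ ≤ P.natDegree := P.card_roots'
    _ ≤ N := hdeg

theorem phi_nsmul {t : ℕ} {F : Type*} [Field F] (φ : ZMod t → F)
    (hadd : ∀ a b, φ (a + b) = φ a * φ b) (hne : ∀ a, φ a ≠ 0) (n : ℕ) (a : ZMod t) :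
    φ ((n : ZMod t) * a) = φ a ^ n := by
  have h0 : φ 0 = 1 := by
    have := hadd 0 0
    rw [add_zero] at this
    exact (mul_eq_left₀ (hne 0)).mp this.symm
  induction n with
  | zero => simp [h0]
  | succ k ih => rw [Nat.cast_succ, add_mul, one_mul, hadd, ih, pow_succ]

/-- pigeonhole -/
theorem aux_pigeon (t n R : ℕ) [NeZero t] (hnpos : 0 < n) (hn : n ^ 3 < R) (a b c : ZMod t) :
    ∃ r : ℕ, 0 < r ∧ r < R ∧ ∃ e2 e3 e4 : ℕ, e2 ≤ 2 * (t / n) ∧ e3 ≤ 2 * (t / n) ∧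
      e4 ≤ 2 * (t / n) ∧ (e2 : ZMod t) = (t / n : ℕ) + r * a ∧
      (e3 : ZMod t) = (t / n : ℕ) + r * b ∧ (e4 : ZMod t) = (t / n : ℕ) + r * c := by
  have ht : 0 < t := Nat.pos_of_ne_zero (NeZero.ne t)
  let f : ℕ → ℕ × ℕ × ℕ := fun r => (((r : ZMod t) * a).val * n / t, ((r : ZMod t) * b).val * n / t,
    ((r : ZMod t) * c).val * n / t)
  have hval : ∀ z : ZMod t, z.val * n / t ∈ Finset.range n := by
    intro z
    rw [Finset.mem_range, Nat.div_lt_iff_lt_mul ht, mul_comm]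
    exact Nat.mul_lt_mul_of_pos_left (ZMod.val_lt z) hnpos
  obtain ⟨i, hi, j, hj, hij, hf⟩ := Finset.exists_ne_map_eq_of_card_lt_of_maps_to
    (s := Finset.range R) (t := Finset.range n ×ˢ Finset.range n ×ˢ Finset.range n) (f := f)
    (by simp only [Finset.card_product, Finset.card_range]; calc _ = n ^ 3 := by ring
          _ < R := hn)
    (by intro r _; simp only [f, Finset.coe_product, Finset.mem_coe, Set.mem_prod]; exact ⟨hval _, hval _, hval _⟩)
  wlog hlt : j < i generalizing i j
  · exact this j hj i hi (Ne.symm hij) hf.symm (by omega)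
  simp only [Finset.mem_range] at hi hj
  have step : ∀ z : ZMod t, ((i : ZMod t) * z).val * n / t = ((j : ZMod t) * z).val * n / t →
      ∃ e : ℕ, e ≤ 2 * (t / n) ∧ (e : ZMod t) = (t / n : ℕ) + ((i - j : ℕ) : ZMod t) * z := by
    intro z hz
    set u := ((i : ZMod t) * z).val with hu
    set v := ((j : ZMod t) * z).val with hv
    have h1 : u * n < v * n + t := by
      have := Nat.div_add_mod (u * n) t
      have := Nat.div_add_mod (v * n) t
      have := Nat.mod_lt (u * n) ht
      rw [hz] at *
      omega
    have h2 : v * n < u * n + t := by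
      have := Nat.div_add_mod (u * n) t
      have := Nat.div_add_mod (v * n) t
      have := Nat.mod_lt (v * n) ht
      rw [hz] at *
      omega
    have h3 : u ≤ v + t / n := by
      by_contra hh
      have : u - v ≤ t / n := by
        rw [Nat.le_div_iff_mul_le hnpos, Nat.sub_mul]; omega
      omega
    have h4 : v ≤ u + t / n := by
      by_contra hh
      have : v - u ≤ t / n := by
        rw [Nat.le_div_iff_mul_le hnpos, Nat.sub_mul]; omega
      omega
    refine ⟨t / n + u - v, by omega, ?_⟩
    rw [Nat.cast_sub (by omega), Nat.cast_sub hlt.le, Nat.cast_add, hu, hv, ZMod.natCast_zmod_val,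
      ZMod.natCast_zmod_val]
    ring
  simp only [f, Prod.mk.injEq] at hf
  obtain ⟨e2, h2, h2'⟩ := step a hf.1
  obtain ⟨e3, h3, h3'⟩ := step b hf.2.1
  obtain ⟨e4, h4, h4'⟩ := step c hf.2.2
  exact ⟨i - j, by omega, by omega, e2, e3, e4, h2, h3, h4, h2', h3', h4'⟩

theorem K_bound (t : ℕ) [NeZero t] {F : Type*} [Field F] [DecidableEq F] (φ : ZMod t → F)
    (hadd : ∀ a b, φ (a + b) = φ a * φ b) (hne : ∀ a, φ a ≠ 0) (hinj : Function.Injective φ)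
    (x1 x2 x3 x4 : ZMod t) (R : ℕ)
    (hR1 : ∀ r : ℕ, 0 < r → r < R → ¬ (r * x1 = r * x3 ∧ r * x2 = r * x4))
    (hR2 : ∀ r : ℕ, 0 < r → r < R → ¬ (r * x1 = r * x4 ∧ r * x2 = r * x3))
    (hR3 : ∀ r : ℕ, 0 < r → r < R → ¬ (r * x1 = r * x2 ∧ r * x3 = r * x4)) :
    (Finset.univ.filter (fun y : ZMod t => φ (x1 * y) + φ (x2 * y) = φ (x3 * y) + φ (x4 * y))).card ^ 3
      * R ≤ 64 * t ^ 3 := by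
  have ht : 0 < t := Nat.pos_of_ne_zero (NeZero.ne t)
  set A := Finset.univ.filter (fun y : ZMod t => φ (x1 * y) + φ (x2 * y) = φ (x3 * y) + φ (x4 * y)) with hA
  have hAt : A.card ≤ t := by
    calc A.card ≤ (Finset.univ : Finset (ZMod t)).card := Finset.card_le_univ _
      _ = t := by rw [Finset.card_univ, ZMod.card]
  rcases Nat.lt_or_ge R 2 with hR | hR
  · have : A.card ^ 3 ≤ t ^ 3 := Nat.pow_le_pow_left hAt 3
    calc A.card ^ 3 * R ≤ t ^ 3 * 1 := Nat.mul_le_mul this (by omega)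
      _ ≤ 64 * t ^ 3 := by omega
  obtain ⟨n, hn1, hnR, hRn⟩ : ∃ n : ℕ, 1 ≤ n ∧ n ^ 3 < R ∧ R ≤ (n + 1) ^ 3 := by
    have hex : ∃ k : ℕ, R ≤ (k + 1) ^ 3 := ⟨R, by nlinarith [Nat.zero_le (R^3), Nat.zero_le (R^2)]⟩
    refine ⟨Nat.find hex, ?_, ?_, Nat.find_spec hex⟩
    · by_contra h
      have h0 : Nat.find hex = 0 := by omega
      have := Nat.find_spec hex
      rw [h0] at this
      omega
    · rcases Nat.eq_zero_or_pos (Nat.find hex) with h0 | h0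
      · rw [h0]; omega
      · have := Nat.find_min hex (m := Nat.find hex - 1) (by omega)
        rw [Nat.sub_add_cancel h0] at this
        omega
  obtain ⟨r, hr0, hrR, e2, e3, e4, l2, l3, l4, h2, h3, h4⟩ :=
    aux_pigeon t n R hn1 hnR (x2 - x1) (x3 - x1) (x4 - x1)
  set L := t / n with hL
  have h1 : (L : ZMod t) = L + r * (x1 - x1) := by simp
  have hfib : ∀ a : ZMod t, (Finset.univ.filter (fun b : ZMod t => a + r * b ∈ A)).card ≤ 2 * L := by
    intro a
    rw [← Finset.card_image_of_injective _ hinj]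
    refine aux_poly L e2 e3 e4 (2 * L) (φ (x1 * a)) (φ (x2 * a)) (φ (x3 * a)) (φ (x4 * a))
      (hne _) (hne _) (hne _) (hne _) (by omega) l2 l3 l4 ?_ ?_ ?_ _ ?_
    · rintro ⟨ha, hb⟩
      apply hR1 r hr0 hrR
      constructor
      · rw [← ha] at h3; linear_combination h3 - h1
      · rw [hb, h4] at h2; linear_combination -h2
    · rintro ⟨ha, hb⟩
      apply hR2 r hr0 hrR
      constructor
      · rw [← ha] at h4; linear_combination h4 - h1
      · rw [hb, h3] at h2; linear_combination -h2
    · rintro ⟨ha, hb⟩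
      apply hR3 r hr0 hrR
      constructor
      · rw [← ha] at h2; linear_combination h2 - h1
      · rw [hb, h4] at h3; linear_combination -h3
    · intro w hw
      simp only [Finset.mem_image, Finset.mem_filter, Finset.mem_univ, true_and, hA] at hw
      obtain ⟨b, hb, rfl⟩ := hw
      have key : ∀ (x : ZMod t) (e : ℕ), (e : ZMod t) = L + r * (x - x1) →
          φ (x * a) * φ b ^ e = φ ((L - r * x1) * b) * φ (x * (a + r * b)) := by
        intro x e he
        rw [← phi_nsmul φ hadd hne, ← hadd, ← hadd, he]
        congr 1
        ring
      rw [key x1 L h1, key x2 e2 h2, key x3 e3 h3, key x4 e4 h4, ← mul_add, ← mul_add, hb]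
  have hdouble : t * A.card ≤ t * (2 * L) := by
    have e1 : ∑ a : ZMod t, (Finset.univ.filter (fun b : ZMod t => a + r * b ∈ A)).card
        = ∑ b : ZMod t, (Finset.univ.filter (fun a : ZMod t => a + r * b ∈ A)).card := by
      simp only [Finset.card_filter]
      exact Finset.sum_comm
    have e2 : ∀ b : ZMod t, (Finset.univ.filter (fun a : ZMod t => a + r * b ∈ A)).card = A.card := by
      intro b
      refine Finset.card_bij (fun a _ => a + r * b) (by simp) (by simp) ?_
      intro y hy
      exact ⟨y - r * b, by simpa using hy, by simp⟩
    calc t * A.card = ∑ b : ZMod t, (Finset.univ.filter (fun a : ZMod t => a + r * b ∈ A)).card := by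
          simp [e2, ZMod.card]
      _ = _ := e1.symm
      _ ≤ ∑ a : ZMod t, 2 * L := Finset.sum_le_sum (fun a _ => hfib a)
      _ = t * (2 * L) := by simp [ZMod.card]
  have hAL : A.card ≤ 2 * L := Nat.le_of_mul_le_mul_left hdouble ht
  have hLn : L * n ≤ t := Nat.div_mul_le_self t n
  have hAn : A.card * n ≤ 2 * t := by nlinarith
  have hR8 : R ≤ 8 * n ^ 3 := by
    calc R ≤ (n + 1) ^ 3 := hRn
      _ ≤ (2 * n) ^ 3 := Nat.pow_le_pow_left (by omega) 3
      _ = 8 * n ^ 3 := by ring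
  calc A.card ^ 3 * R ≤ A.card ^ 3 * (8 * n ^ 3) := Nat.mul_le_mul_left _ hR8
    _ = 8 * (A.card * n) ^ 3 := by ring
    _ ≤ 8 * (2 * t) ^ 3 := Nat.mul_le_mul_left _ (Nat.pow_le_pow_left hAn 3)
    _ = 64 * t ^ 3 := by ring

open Polynomial in
theorem X_mul_der {F : Type*} [Field F] (e : ℕ) : X * derivative (X ^ e : F[X]) = (e : F[X]) * X ^ e := by
  rcases e with _ | e
  · simp
  · rw [derivative_X_pow, map_natCast, add_tsub_cancel_right]; ring

open Polynomial in
theorem one_X_mul_der {F : Type*} [Field F] (e : ℕ) :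
    (1 - X) * derivative ((1 - X) ^ e : F[X]) = - (e : F[X]) * (1 - X) ^ e := by
  rcases e with _ | e
  · simp
  · rw [derivative_pow, map_natCast, add_tsub_cancel_right, derivative_sub, derivative_one, derivative_X]; ring

open Polynomial in
theorem sparse_zero (p : ℕ) [Fact p.Prime] (E : Finset ℕ) : ∀ (c : ℕ → ZMod p), (∀ e ∈ E, e < p) →
    (X - C 1 : (ZMod p)[X]) ^ E.card ∣ ∑ e ∈ E, C (c e) * X ^ e → ∀ e ∈ E, c e = 0 := by
  classical
  induction E using Finset.induction_on with
  | empty => simp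
  | insert a s ha ih =>
    intro c hp hdvd
    rw [Finset.card_insert_of_notMem ha] at hdvd
    set P := ∑ e ∈ insert a s, C (c e) * X ^ e with hP
    have hQ : X * derivative P - C (a : ZMod p) * P
        = ∑ e ∈ s, C (c e * ((e : ZMod p) - a)) * X ^ e := by
      have hterm : ∀ e : ℕ, X * derivative (C (c e) * X ^ e) - C (a : ZMod p) * (C (c e) * X ^ e)
          = C (c e * ((e : ZMod p) - a)) * X ^ e := by
        intro e
        rw [derivative_mul, derivative_C, zero_mul, zero_add, C_mul, C_sub, map_natCast, map_natCast]
        linear_combination C (c e) * X_mul_der (F := ZMod p) e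
      rw [hP, derivative_sum, Finset.mul_sum, Finset.mul_sum, ← Finset.sum_sub_distrib,
        Finset.sum_congr rfl (fun e _ => hterm e), Finset.sum_insert ha]
      simp
    have hd1 : (X - C 1 : (ZMod p)[X]) ^ s.card ∣ X * derivative P - C (a : ZMod p) * P := by
      obtain ⟨G, hG⟩ := hdvd
      refine ⟨X * (((s.card + 1 : ℕ) : (ZMod p)[X]) * G + (X - C 1) * derivative G) - C (a : ZMod p) * ((X - C 1) * G), ?_⟩
      rw [hG, derivative_mul, derivative_X_sub_C_pow]
      simp only [add_tsub_cancel_right, pow_succ, map_natCast]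
      ring
    rw [hQ] at hd1
    have hs := ih (fun e => c e * ((e : ZMod p) - a)) (fun e he => hp e (Finset.mem_insert_of_mem he)) hd1
    have hs' : ∀ e ∈ s, c e = 0 := by
      intro e he
      rcases mul_eq_zero.mp (hs e he) with h | h
      · exact h
      · exfalso
        have h1 : (e : ZMod p) = a := sub_eq_zero.mp h
        rw [ZMod.natCast_eq_natCast_iff'] at h1
        rw [Nat.mod_eq_of_lt (hp e (Finset.mem_insert_of_mem he)),
          Nat.mod_eq_of_lt (hp a (Finset.mem_insert_self a s))] at h1
        exact ha (h1 ▸ he)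
    have hPa : P = C (c a) * X ^ a := by
      rw [hP, Finset.sum_insert ha, Finset.sum_eq_zero, add_zero]
      intro e he; rw [hs' e he]; simp
    have hroot : P.eval 1 = 0 := by
      obtain ⟨G, hG⟩ := hdvd
      rw [hG]; simp
    intro e he
    rcases Finset.mem_insert.mp he with rfl | he
    · rw [hPa] at hroot; simpa using hroot
    · exact hs' e he

open Polynomial in
theorem indep1 (p : ℕ) [Fact p.Prime] (t A B : ℕ) (hA : A ≤ t) (hAB : A * B ≤ t) (htB : t * B ≤ p)
    (c : ℕ → ℕ → ZMod p)
    (h : (X : (ZMod p)[X]) ^ t ∣ ∑ x ∈ Finset.range A ×ˢ Finset.range B,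
      C (c x.1 x.2) * (1 - X) ^ (x.1 + t * x.2)) :
    ∀ i < A, ∀ k < B, c i k = 0 := by
  classical
  intro i hi k hk
  have htpos : 0 < t := by omega
  have hmod : ∀ i k, i < A → (i + t * k) % t = i ∧ (i + t * k) / t = k := by
    intro i k hi
    constructor
    · rw [Nat.add_mul_mod_self_left, Nat.mod_eq_of_lt (by omega)]
    · rw [Nat.add_mul_div_left _ _ htpos, Nat.div_eq_of_lt (by omega), zero_add]
  have hinj : Set.InjOn (fun x : ℕ × ℕ => x.1 + t * x.2) (Finset.range A ×ˢ Finset.range B : Finset (ℕ × ℕ)) := by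
    rintro ⟨i, k⟩ hx ⟨i', k'⟩ hy hxy
    simp only [Finset.coe_product, Finset.coe_range, Set.mem_prod, Set.mem_Iio] at hx hy
    have h1 := hmod i k hx.1
    have h2 := hmod i' k' hy.1
    simp only at hxy
    rw [hxy] at h1
    rw [Prod.mk.injEq]
    exact ⟨h1.1.symm.trans h2.1, h1.2.symm.trans h2.2⟩
  set E := (Finset.range A ×ˢ Finset.range B).image (fun x : ℕ × ℕ => x.1 + t * x.2) with hE
  have hcard : E.card ≤ t := by
    rw [hE, Finset.card_image_of_injOn hinj]; simpa using hAB
  have key := sparse_zero p E (fun e => c (e % t) (e / t)) ?_ ?_ (i + t * k) ?_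
  · simpa [hmod i k hi] using key
  · intro e he
    simp only [hE, Finset.mem_image, Finset.mem_product, Finset.mem_range] at he
    obtain ⟨x, ⟨h1, h2⟩, rfl⟩ := he
    calc x.1 + t * x.2 < t + t * x.2 := by omega
      _ = t * (x.2 + 1) := by ring
      _ ≤ t * B := Nat.mul_le_mul_left _ h2
      _ ≤ p := htB
  · have h2 : ((X : (ZMod p)[X]) ^ t).comp (1 - X) ∣ (∑ x ∈ Finset.range A ×ˢ Finset.range B,
      C (c x.1 x.2) * (1 - X) ^ (x.1 + t * x.2)).comp (1 - X) := by
      obtain ⟨G, hG⟩ := h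
      exact ⟨G.comp (1 - X), by rw [hG, mul_comp]⟩
    have h3 : (∑ x ∈ Finset.range A ×ˢ Finset.range B,
      C (c x.1 x.2) * (1 - X) ^ (x.1 + t * x.2)).comp (1 - X) =
        ∑ e ∈ E, C (c (e % t) (e / t)) * X ^ e := by
      rw [hE, Finset.sum_image hinj, Polynomial.sum_comp]
      refine Finset.sum_congr rfl ?_
      rintro ⟨i, k⟩ hx
      simp only [Finset.mem_product, Finset.mem_range] at hx
      simp [(hmod i k hx.1).1, (hmod i k hx.1).2]
    rw [h3] at h2
    refine dvd_trans ?_ h2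
    have h4 : ((X : (ZMod p)[X]) ^ t).comp (1 - X) = (-1) ^ t * (X - C 1) ^ t := by
      rw [← mul_pow]; simp
    rw [h4]
    exact Dvd.dvd.mul_left (pow_dvd_pow _ hcard) _
  · rw [hE, Finset.mem_image]
    exact ⟨(i, k), by simp [hi, hk], rfl⟩

open Polynomial in
theorem indep2 {F : Type*} [Field F] (t B : ℕ) (g : ℕ → F[X])
    (hg : ∀ j, X ^ t ∣ g j → g j = 0) (h : ∑ j ∈ Finset.range B, X ^ (t * j) * g j = 0) :
    ∀ j < B, g j = 0 := by
  induction B generalizing g with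
  | zero => simp
  | succ B ih =>
    rw [Finset.sum_range_succ'] at h
    have e : ∑ j ∈ Finset.range B, X ^ (t * (j + 1)) * g (j + 1)
        = X ^ t * ∑ j ∈ Finset.range B, X ^ (t * j) * g (j + 1) := by
      rw [Finset.mul_sum]
      refine Finset.sum_congr rfl fun j _ => ?_
      ring
    rw [e] at h
    simp only [mul_zero, pow_zero, one_mul] at h
    have h0 : g 0 = 0 := by
      apply hg
      rw [eq_neg_of_add_eq_zero_right h]
      exact (dvd_neg).mpr (dvd_mul_right _ _)
    rw [h0, add_zero] at h
    have h1 := (mul_eq_zero.mp h).resolve_left (pow_ne_zero _ X_ne_zero)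
    have := ih (fun j => g (j + 1)) (fun j => hg (j + 1)) h1
    intro j hj
    rcases j with _ | j
    · exact h0
    · exact this j (by omega)

noncomputable section
open Polynomial

def Tab (F : Type*) [Field F] (a b : ℕ) : F[X] →ₗ[F] F[X] :=
  LinearMap.mulLeft F (X * (1 - X)) ∘ₗ derivative
    + LinearMap.mulLeft F ((a : F[X]) * (1 - X) - (b : F[X]) * X)

theorem Tab_apply {F : Type*} [Field F] (a b : ℕ) (h : F[X]) :
    Tab F a b h = X * (1 - X) * derivative h + ((a : F[X]) * (1 - X) - (b : F[X]) * X) * h := by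
  simp [Tab, mul_assoc]

theorem Tab_mul {F : Type*} [Field F] (a b : ℕ) (h : F[X]) :
    Tab F 0 0 (h * (X ^ a * (1 - X) ^ b)) = Tab F a b h * (X ^ a * (1 - X) ^ b) := by
  rw [Tab_apply, Tab_apply]
  rw [derivative_mul, derivative_mul]
  simp only [Nat.cast_zero]
  linear_combination h * (1 - X) * (1 - X) ^ b * X_mul_der (F := F) a
    + h * X * X ^ a * one_X_mul_der (F := F) b

theorem Tab_iter {F : Type*} [Field F] (a b m : ℕ) (h : F[X]) :
    (Tab F 0 0 ^ m) (h * (X ^ a * (1 - X) ^ b)) = (Tab F a b ^ m) h * (X ^ a * (1 - X) ^ b) := by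
  induction m with
  | zero => simp
  | succ m ih => rw [pow_succ', pow_succ', Module.End.mul_apply, Module.End.mul_apply, ih, Tab_mul]

theorem Tab_deg {F : Type*} [Field F] (a b : ℕ) (h : F[X]) (d : ℕ) (hd : h.natDegree ≤ d) :
    (Tab F a b h).natDegree ≤ d + 1 := by
  rw [Tab_apply]
  have h1 : (1 - X : F[X]).natDegree ≤ 1 := by
    refine (natDegree_sub_le _ _).trans ?_
    simp
  refine natDegree_add_le_of_degree_le ?_ ?_
  · rcases Nat.eq_zero_or_pos h.natDegree with h0 | h0
    · rw [derivative_of_natDegree_zero h0]; simp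
    · have h2 := natDegree_derivative_lt (p := h) (by omega)
      have h3 : (X * (1 - X) : F[X]).natDegree ≤ 2 :=
        natDegree_mul_le_of_le (m := 1) (n := 1) natDegree_X_le h1
      have := natDegree_mul_le_of_le h3 (le_refl (derivative h).natDegree)
      omega
  · rw [add_comm d 1]
    refine natDegree_mul_le_of_le ?_ hd
    refine natDegree_sub_le_of_le (m := 1) (n := 1) ?_ ?_ |>.trans (by simp)
    · have := natDegree_mul_le_of_le (le_of_eq (natDegree_natCast (R := F) a)) h1
      simpa using this
    · have := natDegree_mul_le_of_le (le_of_eq (natDegree_natCast (R := F) b)) (natDegree_X_le (R := F))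
      simpa using this

theorem Tab_deg_iter {F : Type*} [Field F] (a b m : ℕ) (h : F[X]) (d : ℕ) (hd : h.natDegree ≤ d) :
    ((Tab F a b ^ m) h).natDegree ≤ d + m := by
  induction m with
  | zero => simpa
  | succ m ih => rw [pow_succ', Module.End.mul_apply]; exact Tab_deg _ _ _ _ ih

theorem mult_of_Tab (p : ℕ) [Fact p.Prime] (z : ZMod p) (hz0 : z ≠ 0) (hz1 : z ≠ 1) (M : ℕ) (hM : M ≤ p) :
    ∀ P : (ZMod p)[X], (∀ m < M, ((Tab (ZMod p) 0 0 ^ m) P).eval z = 0) → (X - C z) ^ M ∣ P := by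
  induction M with
  | zero => simp
  | succ M ih =>
    intro P hP
    have hd : (X - C z) ^ M ∣ derivative P := by
      have h1 := ih (by omega) (Tab (ZMod p) 0 0 P) (fun m hm => by
        have := hP (m + 1) (by omega)
        rwa [pow_succ, Module.End.mul_apply] at this)
      rw [Tab_apply] at h1
      simp only [Nat.cast_zero, zero_mul, sub_zero, add_zero] at h1
      refine IsCoprime.dvd_of_dvd_mul_left ?_ h1
      apply IsCoprime.pow_left
      rw [Polynomial.irreducible_X_sub_C z |>.coprime_iff_not_dvd, dvd_iff_isRoot]
      simp [hz0, sub_eq_zero, Ne.symm hz1]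
    obtain ⟨G, hG⟩ := ih (by omega) P (fun m hm => hP m (by omega))
    rcases M with _ | M
    · have := hP 0 (by omega)
      rw [zero_add, pow_one, dvd_iff_isRoot]
      simpa using this
    · rw [hG, derivative_mul, derivative_X_sub_C_pow] at hd
      have h2 : (X - C z) ^ (M + 1) ∣ (X - C z) ^ M * (C ((M + 1 : ℕ) : ZMod p) * G) := by
        have h4 := dvd_sub hd (dvd_mul_right ((X - C z) ^ (M + 1)) (derivative G))
        rw [add_sub_cancel_right, add_tsub_cancel_right] at h4
        rw [← mul_assoc, mul_comm ((X - C z) ^ M)]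
        exact h4
      rw [pow_succ] at h2
      have h3 := (mul_dvd_mul_iff_left (pow_ne_zero M (X_sub_C_ne_zero z))).mp h2
      rw [dvd_iff_isRoot] at h3
      have hne : ((M + 1 : ℕ) : ZMod p) ≠ 0 := by
        rw [Ne, ZMod.natCast_eq_zero_iff]
        exact Nat.not_dvd_of_pos_of_lt (by omega) (by omega)
      have h4 : G.IsRoot z := by
        simp only [IsRoot, eval_mul, eval_C] at h3
        exact (mul_eq_zero.mp h3).resolve_left hne
      rw [← dvd_iff_isRoot] at h4
      rw [hG, pow_succ _ (M + 1)]
      exact mul_dvd_mul_left _ h4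

end
noncomputable section
open Polynomial

theorem indep3 (p : ℕ) [Fact p.Prime] (t A B : ℕ) (hA : A ≤ t) (hAB : A * B ≤ t) (htB : t * B ≤ p)
    (c : Fin A × Fin B × Fin B → ZMod p)
    (h : ∑ x, c x • ((1 - X : (ZMod p)[X]) ^ (x.1 : ℕ) * (X ^ (t * (x.2.1 : ℕ)) * (1 - X) ^ (t * (x.2.2 : ℕ)))) = 0) :
    c = 0 := by
  classical
  let c' : ℕ → ℕ → ℕ → ZMod p := fun i j k =>
    if h : i < A ∧ j < B ∧ k < B then c (⟨i, h.1⟩, ⟨j, h.2.1⟩, ⟨k, h.2.2⟩) else 0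
  have hc' : ∀ (i : Fin A) (j k : Fin B), c' i j k = c (i, j, k) := by
    intro i j k
    simp [c']
  let g : ℕ → (ZMod p)[X] := fun j => ∑ x ∈ Finset.range A ×ˢ Finset.range B,
      C (c' x.1 j x.2) * (1 - X) ^ (x.1 + t * x.2)
  have hg0 : ∀ j, X ^ t ∣ g j → ∀ i < A, ∀ k < B, c' i j k = 0 := fun j hj =>
    indep1 p t A B hA hAB htB (fun i k => c' i j k) hj
  have hsum : ∑ j ∈ Finset.range B, X ^ (t * j) * g j = 0 := by
    rw [← h, Fintype.sum_prod_type, Finset.sum_range]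
    simp only [Fintype.sum_prod_type]
    rw [Finset.sum_comm]
    refine Finset.sum_congr rfl fun j _ => ?_
    simp only [g, Finset.sum_product, Finset.sum_range, Finset.mul_sum, hc']
    refine Finset.sum_congr rfl fun i _ => Finset.sum_congr rfl fun k _ => ?_
    rw [smul_eq_C_mul, pow_add]
    ring
  have hg := indep2 t B g (fun j hj => by
    have h0 := hg0 j hj
    refine Finset.sum_eq_zero ?_
    intro x hx
    simp only [Finset.mem_product, Finset.mem_range] at hx
    rw [h0 x.1 hx.1 x.2 hx.2]; simp) hsum
  funext ⟨i, j, k⟩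
  rw [← hc']
  exact hg0 j (by rw [hg j j.2]; exact dvd_zero _) i i.2 k k.2

theorem natDegree_one_sub_X_pow {F : Type*} [Field F] (i : ℕ) : ((1 - X : F[X]) ^ i).natDegree ≤ i := by
  have h1 : (1 - X : F[X]).natDegree ≤ 1 := by
    refine (natDegree_sub_le _ _).trans ?_
    simp
  simpa using natDegree_pow_le_of_le i h1

theorem stepanov (p : ℕ) [Fact p.Prime] (t b : ℕ) (hb : 1 ≤ b) (h4 : 4 * b ^ 3 ≤ t) (hp : t * (2 * b) ≤ p)
    (α β : ZMod p) (Z : Finset (ZMod p))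
    (hZ : ∀ z ∈ Z, z ≠ 0 ∧ z ≠ 1 ∧ z ^ t = α ∧ (1 - z) ^ t = β) : Z.card * b ≤ 3 * t := by
  classical
  set A := 2 * b ^ 2 with hA
  set B := 2 * b with hB
  have hApos : 0 < A := by positivity
  have hAB : A * B ≤ t := by rw [hA, hB]; linarith [show 2 * b ^ 2 * (2 * b) = 4 * b ^ 3 by ring]
  have hAt : A ≤ t := by nlinarith
  have hAp : A ≤ p := by nlinarith
  let W : (m : ℕ) → (Fin A × Fin B × Fin B → ZMod p) →ₗ[ZMod p] (ZMod p)[X] := fun m =>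
    ∑ x : Fin A × Fin B × Fin B, (LinearMap.proj x : (Fin A × Fin B × Fin B → ZMod p) →ₗ[ZMod p] ZMod p).smulRight
      ((α ^ (x.2.1 : ℕ) * β ^ (x.2.2 : ℕ)) •
        (Tab (ZMod p) (t * x.2.1) (t * x.2.2) ^ m) ((1 - X : (ZMod p)[X]) ^ (x.1 : ℕ)))
  have hW : ∀ m c, W m c = ∑ x : Fin A × Fin B × Fin B, c x • ((α ^ (x.2.1 : ℕ) * β ^ (x.2.2 : ℕ)) •
        (Tab (ZMod p) (t * x.2.1) (t * x.2.2) ^ m) ((1 - X : (ZMod p)[X]) ^ (x.1 : ℕ))) := by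
    intro m c
    simp [W]
  have hWdeg : ∀ m < A, ∀ c, (W m c).natDegree < 2 * A - 1 := by
    intro m hm c
    have : (W m c).natDegree ≤ 2 * A - 2 := by
      rw [hW]
      refine natDegree_sum_le_of_forall_le _ _ fun x _ => ?_
      refine (natDegree_smul_le _ _).trans ((natDegree_smul_le _ _).trans ?_)
      refine (Tab_deg_iter _ _ m _ _ (natDegree_one_sub_X_pow _)).trans ?_
      have := x.1.2
      omega
    omega
  let Φ : (Fin A × Fin B × Fin B → ZMod p) →ₗ[ZMod p] (Fin A × Fin (2 * A - 1) → ZMod p) :=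
    LinearMap.pi fun y => (Polynomial.lcoeff (ZMod p) y.2) ∘ₗ W y.1
  have hker : LinearMap.ker Φ ≠ ⊥ := by
    apply LinearMap.ker_ne_bot_of_finrank_lt
    simp only [Module.finrank_fintype_fun_eq_card, Fintype.card_prod, Fintype.card_fin]
    apply Nat.mul_lt_mul_of_pos_left _ hApos
    have : B * B = 2 * A := by rw [hA, hB]; ring
    omega
  obtain ⟨c, hc, hc0⟩ := (Submodule.ne_bot_iff _).mp hker
  have hWc : ∀ m < A, W m c = 0 := by
    intro m hm
    ext d
    rcases Nat.lt_or_ge d (2 * A - 1) with hd | hd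
    · have := congrFun (LinearMap.mem_ker.mp hc) (⟨m, hm⟩, ⟨d, hd⟩)
      simpa [Φ] using this
    · rw [coeff_zero, coeff_eq_zero_of_natDegree_lt]
      exact (hWdeg m hm c).trans_le hd
  set P : (ZMod p)[X] := ∑ x : Fin A × Fin B × Fin B,
    c x • ((1 - X : (ZMod p)[X]) ^ (x.1 : ℕ) * (X ^ (t * (x.2.1 : ℕ)) * (1 - X) ^ (t * (x.2.2 : ℕ)))) with hP
  have hP0 : P ≠ 0 := fun h => hc0 (indep3 p t A B hAt hAB hp c h)
  have hdvd : ∀ z ∈ Z, (X - C z) ^ A ∣ P := by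
    intro z hz
    obtain ⟨z0, z1, za, zb⟩ := hZ z hz
    refine mult_of_Tab p z z0 z1 A hAp P ?_
    intro m hm
    have : ((Tab (ZMod p) 0 0 ^ m) P).eval z = (W m c).eval z := by
      rw [hP, hW, map_sum, eval_finsetSum, eval_finsetSum]
      refine Finset.sum_congr rfl fun x _ => ?_
      rw [map_smul, Tab_iter]
      simp only [eval_smul, eval_mul, eval_pow, eval_X, eval_sub, eval_one, pow_mul, za, zb, smul_eq_mul]
      ring
    rw [this, hWc m hm, eval_zero]
  have hprod : ∏ z ∈ Z, (X - C z) ^ A ∣ P := by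
    refine Finset.prod_dvd_of_coprime ?_ hdvd
    intro z _ w _ hzw
    exact (isCoprime_X_sub_C_of_isUnit_sub (sub_ne_zero.mpr hzw).isUnit).pow
  have hd1 := natDegree_le_of_dvd hprod hP0
  have hd2 : (∏ z ∈ Z, (X - C z) ^ A).natDegree = Z.card * A := by
    rw [natDegree_prod_of_monic _ _ (fun z _ => (monic_X_sub_C z).pow A)]
    simp
  have hd3 : P.natDegree ≤ A + 2 * (t * B) := by
    rw [hP]
    refine natDegree_sum_le_of_forall_le _ _ fun x _ => ?_
    refine (natDegree_smul_le _ _).trans ?_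
    refine (natDegree_mul_le_of_le (natDegree_one_sub_X_pow _) (natDegree_mul_le_of_le
      (natDegree_X_pow_le _) (natDegree_one_sub_X_pow _))).trans ?_
    have h1 := x.1.2
    have h2 := Nat.mul_le_mul_left t x.2.1.2.le
    have h3 := Nat.mul_le_mul_left t x.2.2.2.le
    omega
  rw [hd2] at hd1
  have h5 := hd1.trans hd3
  have h6 : (2 * b) * (Z.card * b) ≤ (2 * b) * (b + 2 * t) := by
    calc (2 * b) * (Z.card * b) = Z.card * A := by rw [hA]; ring
      _ ≤ _ := h5
      _ = (2 * b) * (b + 2 * t) := by rw [hA, hB]; ring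
  have h7 := Nat.le_of_mul_le_mul_left h6 (by omega)
  have : b ≤ t := by nlinarith [Nat.pow_le_pow_left hb 2, Nat.pow_le_pow_left hb 3]
  omega

end

noncomputable def Gm (t : ℕ) [NeZero t] (m : ℕ) : Finset (ZMod t) :=
  Finset.univ.filter (fun u => (m : ZMod t) * u = 0)

theorem Gm_card (t : ℕ) [NeZero t] (m : ℕ) (hm : 0 < m) : (Gm t m).card ≤ m := by
  have := IsAddCyclic.card_nsmul_eq_zero_le (α := ZMod t) hm
  simpa [Gm, nsmul_eq_mul] using this

theorem parseval (p : ℕ) [Fact p.Prime] {ι : Type*} [DecidableEq ι] (I : Finset ι) (f : ι → ZMod p) :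
    ∑ ξ : ZMod p, ‖∑ i ∈ I, ZMod.stdAddChar (ξ * f i)‖ ^ 2
      = p * (((I ×ˢ I).filter (fun q => f q.1 = f q.2)).card : ℝ) := by
  have hC : ((∑ ξ : ZMod p, ‖∑ i ∈ I, ZMod.stdAddChar (ξ * f i)‖ ^ 2 : ℝ) : ℂ)
      = ((p * (((I ×ˢ I).filter (fun q => f q.1 = f q.2)).card : ℝ) : ℝ) : ℂ) := by
    push_cast
    have h1 : ∀ ξ : ZMod p, ((‖∑ i ∈ I, ZMod.stdAddChar (ξ * f i)‖ : ℂ)) ^ 2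
        = ∑ q ∈ I ×ˢ I, ZMod.stdAddChar (ξ * (f q.1 - f q.2)) := by
      intro ξ
      rw [← Complex.mul_conj', map_sum, Finset.sum_mul_sum, Finset.sum_product]
      refine Finset.sum_congr rfl fun i _ => Finset.sum_congr rfl fun j _ => ?_
      rw [← AddChar.map_neg_eq_conj, ← AddChar.map_add_eq_mul]
      congr 1; ring
    rw [Finset.sum_congr rfl fun ξ _ => h1 ξ, Finset.sum_comm]
    have h2 : ∀ q : ι × ι, ∑ ξ : ZMod p, (ZMod.stdAddChar (ξ * (f q.1 - f q.2)) : ℂ)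
        = if f q.1 = f q.2 then (p : ℂ) else 0 := by
      intro q
      rw [AddChar.sum_mulShift _ (ZMod.isPrimitive_stdAddChar p)]
      simp [sub_eq_zero, ZMod.card]
    rw [Finset.sum_congr rfl fun q _ => h2 q, ← Finset.sum_filter, Finset.sum_const, nsmul_eq_mul, mul_comm]
  exact_mod_cast hC

noncomputable def Cs (p t : ℕ) [NeZero t] (φ : ZMod t → ZMod p) (σ : ZMod p) (m : ℕ) :
    Finset (ZMod t × ZMod t × ZMod t × ZMod t) :=
  Finset.univ.filter (fun q => (m : ZMod t) * q.2.1 = 0 ∧ (m : ZMod t) * q.2.2.2 = 0 ∧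
    φ q.1 * (φ q.2.1 + σ) = φ q.2.2.1 * (φ q.2.2.2 + σ) ∧ φ q.2.1 + σ ≠ 0)

section
variable (p t : ℕ) [Fact p.Prime] [NeZero t] (φ : ZMod t → ZMod p)
    (hadd : ∀ a b, φ (a + b) = φ a * φ b) (hne : ∀ a, φ a ≠ 0) (hinj : Function.Injective φ)
    (σ : ZMod p) (hσ : σ = 1 ∨ σ = -1) (m : ℕ) (hm : 0 < m)

include hinj hm in
theorem Cs_one : (Cs p t φ σ m).card ≤ t * m ^ 2 := by
  have h : (Cs p t φ σ m).card ≤ ((Finset.univ : Finset (ZMod t)) ×ˢ Gm t m ×ˢ Gm t m).card := by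
    refine Finset.card_le_card_of_injOn (fun q => (q.2.2.1, q.2.1, q.2.2.2)) ?_ ?_
    · intro q hq
      simp only [Cs, Finset.coe_filter, Finset.mem_univ, true_and, Set.mem_ofPred_eq] at hq
      simp [Gm, hq.1, hq.2.1]
    · rintro ⟨x, u, y, v⟩ hq ⟨x', u', y', v'⟩ hq' h
      simp only [Cs, Finset.coe_filter, Finset.mem_univ, true_and, Set.mem_ofPred_eq] at hq hq'
      simp only [Prod.mk.injEq] at h
      obtain ⟨rfl, rfl, rfl⟩ := h
      have : φ x = φ x' := mul_right_cancel₀ hq.2.2.2 (hq.2.2.1.trans hq'.2.2.1.symm)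
      rw [hinj this]
  refine h.trans ?_
  rw [Finset.card_product, Finset.card_product, Finset.card_univ, ZMod.card]
  have := Gm_card t m hm
  rw [pow_two]
  gcongr

include hadd hne hm in
theorem Cs_two (N : ℕ) (hN : ∀ δ : ZMod p, δ ≠ 0 →
    (Finset.univ.filter (fun q : ZMod t × ZMod t => φ q.1 + σ * φ q.2 = δ)).card ≤ N) :
    (Cs p t φ σ m).card ≤ N * (t * m) := by
  have h := Finset.card_le_mul_card_image_of_maps_to (s := Cs p t φ σ m)
    (t := (Finset.univ : Finset (ZMod t)) ×ˢ Gm t m) (f := fun q => (q.1, q.2.1)) ?_ N ?_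
  · refine h.trans ?_
    rw [Finset.card_product, Finset.card_univ, ZMod.card]
    have := Gm_card t m hm
    gcongr
  · intro q hq
    simp only [Cs, Finset.mem_filter, Finset.mem_univ, true_and] at hq
    simp [Gm, hq.1]
  · rintro ⟨x, u⟩ _
    by_cases h0 : φ u + σ = 0
    · rw [Finset.card_eq_zero.mpr]
      · exact Nat.zero_le _
      · rw [Finset.filter_eq_empty_iff]
        intro q hq hqq
        simp only [Cs, Finset.mem_filter, Finset.mem_univ, true_and] at hq
        simp only [Prod.mk.injEq] at hqq
        rw [hqq.2] at hq
        exact hq.2.2.2 h0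
    refine le_trans ?_ (hN (φ x * (φ u + σ)) (mul_ne_zero (hne x) h0))
    refine Finset.card_le_card_of_injOn (fun q => (q.2.2.1 + q.2.2.2, q.2.2.1)) ?_ ?_
    · rintro ⟨x', u', y, v⟩ hq
      simp only [Cs, Finset.coe_filter, Finset.mem_filter, Finset.mem_univ, true_and, Set.mem_ofPred_eq, Prod.mk.injEq] at hq
      obtain ⟨hq, rfl, rfl⟩ := hq
      simp only [Finset.coe_filter, Finset.mem_univ, true_and, Set.mem_ofPred_eq]
      rw [hq.2.2.1, hadd]; ring
    · rintro ⟨x', u', y, v⟩ hq ⟨x'', u'', y', v'⟩ hq' h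
      simp only [Cs, Finset.coe_filter, Finset.mem_filter, Finset.mem_univ, true_and, Set.mem_ofPred_eq, Prod.mk.injEq] at hq hq'
      simp only [Prod.mk.injEq] at h
      obtain ⟨h1, rfl⟩ := h
      have := add_left_cancel h1
      rw [hq.2.1, hq.2.2, hq'.2.1, hq'.2.2, this]

include hadd hne hinj hσ hm in
theorem Cs_three : (p : ℝ) * (Cs p t φ σ m).card ≤ (t : ℝ) ^ 2 * m ^ 2 + p ^ 2 * t := by
  classical
  set g : ℕ := (Gm t m).card with hg
  have hgm : g ≤ m := Gm_card t m hm
  have hgpos : 0 < g := Finset.card_pos.mpr ⟨0, by simp [Gm]⟩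
  have hp : (0:ℝ) < p := by exact_mod_cast (Fact.out : p.Prime).pos
  let S : ZMod p → ℂ := fun ξ => ∑ u ∈ Gm t m, ZMod.stdAddChar (ξ * φ u)
  have hSneg : ∀ ξ, ‖S (-ξ)‖ = ‖S ξ‖ := by
    intro ξ
    have : S (-ξ) = (starRingEnd ℂ) (S ξ) := by
      simp only [S, map_sum]
      refine Finset.sum_congr rfl fun u _ => ?_
      rw [← AddChar.map_neg_eq_conj, neg_mul]
    rw [this, RCLike.norm_conj]
  have hSσ : ∀ ξ, ‖S (ξ * σ)‖ = ‖S ξ‖ := by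
    intro ξ
    rcases hσ with rfl | rfl
    · rw [mul_one]
    · rw [mul_neg, mul_one, hSneg]
  have hSsum : ∑ ξ : ZMod p, ‖S ξ‖ ^ 2 = p * g := by
    simp only [S]
    rw [parseval]
    congr 2
    rw [hg]
    refine (Finset.card_bij (fun u _ => (u, u)) ?_ ?_ ?_).symm
    · intro u hu; simp [hu]
    · intro u _ v _ h; exact (Prod.mk.inj h).1
    · rintro ⟨u, v⟩ h
      simp only [Finset.mem_filter, Finset.mem_product] at h
      have := hinj h.2
      exact ⟨u, h.1.1, by rw [this]⟩
  let I := (Finset.univ : Finset (ZMod t)) ×ˢ Gm t m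
  let f : ZMod t × ZMod t → ZMod p := fun i => φ i.1 * (φ i.2 + σ)
  let B : ZMod p → ℂ := fun ξ => ∑ i ∈ I, ZMod.stdAddChar (ξ * f i)
  have hBS : ∀ ξ, (g : ℂ) * B ξ = ∑ x : ZMod t, S (ξ * φ x) * S (ξ * φ x * σ) := by
    intro ξ
    have h1 : ∀ v ∈ Gm t m, B ξ = ∑ x : ZMod t, S (ξ * φ x) * ZMod.stdAddChar (ξ * φ x * σ * φ v) := by
      intro v hv
      simp only [B, I, Finset.sum_product]
      rw [← Equiv.sum_comp (Equiv.addRight v)]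
      refine Finset.sum_congr rfl fun x _ => ?_
      simp only [S, f, Finset.sum_mul]
      refine Finset.sum_bij (fun u _ => v + u) ?_ ?_ ?_ ?_
      · intro u hu
        simp only [Gm, Finset.mem_filter, Finset.mem_univ, true_and] at hu hv ⊢
        rw [mul_add, hu, hv, add_zero]
      · intro u _ u' _ h; exact add_left_cancel h
      · intro u hu
        refine ⟨u - v, ?_, by simp⟩
        simp only [Gm, Finset.mem_filter, Finset.mem_univ, true_and] at hu hv ⊢
        rw [mul_sub, hu, hv, sub_zero]
      · intro u _
        rw [← AddChar.map_add_eq_mul]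
        congr 1
        simp only [Equiv.coe_addRight, hadd]
        ring
    have h2 : ∑ v ∈ Gm t m, B ξ = (g : ℂ) * B ξ := by simp [hg]
    rw [← h2, Finset.sum_congr rfl h1, Finset.sum_comm]
    refine Finset.sum_congr rfl fun x _ => ?_
    rw [← Finset.mul_sum]
  have hBle : ∀ ξ, (g : ℝ) * ‖B ξ‖ ≤ ∑ x : ZMod t, ‖S (ξ * φ x)‖ ^ 2 := by
    intro ξ
    have : (g : ℝ) * ‖B ξ‖ = ‖(g : ℂ) * B ξ‖ := by simp
    rw [this, hBS]
    refine (norm_sum_le _ _).trans (le_of_eq ?_)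
    refine Finset.sum_congr rfl fun x _ => ?_
    rw [norm_mul, hSσ, pow_two]
  have hg' : (0:ℝ) < g := by exact_mod_cast hgpos
  have hBp : ∀ ξ, ξ ≠ 0 → ‖B ξ‖ ≤ p := by
    intro ξ hξ
    have h1 : ∑ x : ZMod t, ‖S (ξ * φ x)‖ ^ 2 ≤ p * g := by
      rw [← hSsum]
      have hi : Set.InjOn (fun x : ZMod t => ξ * φ x) (Finset.univ : Finset (ZMod t)) :=
        fun x _ y _ h => hinj (mul_left_cancel₀ hξ h)
      rw [← Finset.sum_image (f := fun η => ‖S η‖ ^ 2) hi]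
      exact Finset.sum_le_sum_of_subset_of_nonneg (Finset.subset_univ _) (fun _ _ _ => by positivity)
    have := (hBle ξ).trans h1
    rw [mul_comm (p:ℝ)] at this
    exact le_of_mul_le_mul_left this hg'
  have hBsum : ∑ ξ : ZMod p, ‖B ξ‖ ≤ t * p := by
    have h1 : (g : ℝ) * ∑ ξ : ZMod p, ‖B ξ‖ ≤ g * (t * p) := by
      rw [Finset.mul_sum]
      refine (Finset.sum_le_sum fun ξ _ => hBle ξ).trans (le_of_eq ?_)
      rw [Finset.sum_comm]
      have : ∀ x : ZMod t, ∑ ξ : ZMod p, ‖S (ξ * φ x)‖ ^ 2 = p * g := by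
        intro x
        rw [← hSsum]
        exact Equiv.sum_comp (Equiv.mulRight₀ (φ x) (hne x)) (fun η => ‖S η‖ ^ 2)
      rw [Finset.sum_congr rfl fun x _ => this x]
      simp [ZMod.card]; ring
    exact le_of_mul_le_mul_left h1 hg'
  have hB0 : ‖B 0‖ = t * g := by
    simp [B, I, ZMod.card, hg]
  have hpar := parseval p I f
  have hcard : (Cs p t φ σ m).card ≤ ((I ×ˢ I).filter (fun q => f q.1 = f q.2)).card := by
    refine Finset.card_le_card_of_injOn (fun q => ((q.1, q.2.1), (q.2.2.1, q.2.2.2))) ?_ ?_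
    · rintro ⟨x, u, y, v⟩ hq
      simp only [Cs, Finset.coe_filter, Finset.mem_univ, true_and, Set.mem_ofPred_eq] at hq
      simp [I, f, Gm, hq.1, hq.2.1, hq.2.2.1]
    · rintro ⟨x, u, y, v⟩ _ ⟨x', u', y', v'⟩ _ h
      simp only [Prod.mk.injEq] at h ⊢
      exact ⟨h.1.1, h.1.2, h.2.1, h.2.2⟩
  calc (p : ℝ) * (Cs p t φ σ m).card ≤ p * (((I ×ˢ I).filter (fun q => f q.1 = f q.2)).card : ℝ) := by
        gcongr
    _ = ∑ ξ : ZMod p, ‖B ξ‖ ^ 2 := hpar.symm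
    _ ≤ ∑ ξ : ZMod p, ((if ξ = 0 then (t * g : ℝ) ^ 2 else 0) + p * ‖B ξ‖) := by
        refine Finset.sum_le_sum fun ξ _ => ?_
        split_ifs with h
        · rw [h, hB0]
          have : 0 ≤ (p:ℝ) * (t * g) := by positivity
          linarith
        · rw [zero_add, pow_two]
          exact mul_le_mul_of_nonneg_right (hBp ξ h) (norm_nonneg _)
    _ = (t * g : ℝ) ^ 2 + p * ∑ ξ : ZMod p, ‖B ξ‖ := by
        rw [Finset.sum_add_distrib, Finset.mul_sum]; simp
    _ ≤ (t * m : ℝ) ^ 2 + p * (t * p) := by gcongr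
    _ = _ := by ring

end
theorem rep_bound (p t : ℕ) [Fact p.Prime] [NeZero t] (φ : ZMod t → ZMod p)
    (hadd : ∀ a b, φ (a + b) = φ a * φ b) (hne : ∀ a, φ a ≠ 0) (hinj : Function.Injective φ)
    (σ : ZMod p) (hσ : σ = 1 ∨ σ = -1) (b : ℕ) (hb : 1 ≤ b) (h4 : 4 * b ^ 3 ≤ t)
    (hp : t * (2 * b) ≤ p) (δ : ZMod p) (hδ : δ ≠ 0) :
    (Finset.univ.filter (fun q : ZMod t × ZMod t => φ q.1 + σ * φ q.2 = δ)).card ≤ 3 * t / b := by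
  classical
  have hσ0 : σ ≠ 0 := by rcases hσ with rfl | rfl <;> simp
  have hpow : ∀ a, φ a ^ t = 1 := by
    intro a
    rw [← phi_nsmul φ hadd hne]
    have := phi_nsmul φ hadd hne 0 a
    simpa using this
  rw [Nat.le_div_iff_mul_le (by omega)]
  set Q := Finset.univ.filter (fun q : ZMod t × ZMod t => φ q.1 + σ * φ q.2 = δ) with hQ
  have hmem : ∀ q ∈ Q, φ q.1 + σ * φ q.2 = δ := by
    intro q hq; simpa [hQ] using hq
  have hinjQ : Set.InjOn (fun q : ZMod t × ZMod t => φ q.1 * δ⁻¹) Q := by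
    intro q hq q' hq' h
    have h1 : φ q.1 = φ q'.1 := mul_right_cancel₀ (inv_ne_zero hδ) h
    have e1 := hmem q hq
    have e2 := hmem q' hq'
    rw [h1, ← e2] at e1
    have h2 : φ q.2 = φ q'.2 := mul_left_cancel₀ hσ0 (add_left_cancel e1)
    exact Prod.ext (hinj h1) (hinj h2)
  rw [← Finset.card_image_of_injOn hinjQ]
  refine stepanov p t b hb h4 hp ((δ⁻¹) ^ t) ((σ * δ⁻¹) ^ t) _ ?_
  intro z hz
  obtain ⟨q, hq, rfl⟩ := Finset.mem_image.mp hz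
  have e1 := hmem q hq
  have e2 : 1 - φ q.1 * δ⁻¹ = φ q.2 * (σ * δ⁻¹) := by
    have : δ * δ⁻¹ = 1 := mul_inv_cancel₀ hδ
    linear_combination -this - δ⁻¹ * e1
  refine ⟨mul_ne_zero (hne _) (inv_ne_zero hδ), ?_, ?_, ?_⟩
  · intro h
    rw [h, sub_self] at e2
    exact mul_ne_zero (hne _) (mul_ne_zero hσ0 (inv_ne_zero hδ)) e2.symm
  · rw [mul_pow, hpow, one_mul]
  · rw [e2, mul_pow, hpow, one_mul]

theorem Cs_bound (p t : ℕ) [Fact p.Prime] [NeZero t] (φ : ZMod t → ZMod p)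
    (hadd : ∀ a b, φ (a + b) = φ a * φ b) (hne : ∀ a, φ a ≠ 0) (hinj : Function.Injective φ)
    (σ : ZMod p) (hσ : σ = 1 ∨ σ = -1) (m : ℕ) (hm : 0 < m) (ht : 4 ≤ t)
    (τ μ : ℝ) (hτ : 0 ≤ τ) (hμ : 0 ≤ μ) (hτt : τ ^ 3 = t) (hμm : μ ^ 2 = m) :
    ((Cs p t φ σ m).card : ℝ) ≤ (t : ℝ) ^ 2 * m ^ 2 / p + 12 * (τ ^ 4 * μ ^ 3) := by
  have hp : (0:ℝ) < p := by exact_mod_cast (Fact.out : p.Prime).pos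
  have hmain : (0:ℝ) ≤ (t : ℝ) ^ 2 * m ^ 2 / p := by positivity
  rcases le_total μ τ with hμτ | hμτ
  · have h1 : ((Cs p t φ σ m).card : ℝ) ≤ t * m ^ 2 := by
      exact_mod_cast Cs_one p t φ hinj σ m hm
    have h2 : (t : ℝ) * m ^ 2 ≤ τ ^ 4 * μ ^ 3 := by
      rw [← hτt, ← hμm]
      calc τ ^ 3 * (μ ^ 2) ^ 2 = τ ^ 3 * μ ^ 3 * μ := by ring
        _ ≤ τ ^ 3 * μ ^ 3 * τ := by gcongr
        _ = _ := by ring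
    have h3 : 0 ≤ τ ^ 4 * μ ^ 3 := by positivity
    linarith
  obtain ⟨b, hb1, hbt, htb⟩ : ∃ b : ℕ, 1 ≤ b ∧ 4 * b ^ 3 ≤ t ∧ t < 4 * (b + 1) ^ 3 := by
    have hex : ∃ k : ℕ, t < 4 * (k + 1) ^ 3 := ⟨t, by nlinarith [Nat.zero_le (t^3), Nat.zero_le (t^2)]⟩
    have hf0 : Nat.find hex ≠ 0 := by
      intro h0
      have := Nat.find_spec hex
      rw [h0] at this
      omega
    refine ⟨Nat.find hex, by omega, ?_, Nat.find_spec hex⟩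
    have := Nat.find_min hex (m := Nat.find hex - 1) (by omega)
    rw [Nat.sub_add_cancel (by omega)] at this
    omega
  by_cases hc : t * (2 * b) ≤ p
  · have h1 := Cs_two p t φ hadd hne σ m hm (3 * t / b)
      (fun δ hδ => rep_bound p t φ hadd hne hinj σ hσ b hb1 hbt hc δ hδ)
    have hb0 : (0:ℝ) < b := by exact_mod_cast hb1
    have h2 : ((3 * t / b : ℕ) : ℝ) * b ≤ 3 * t := by exact_mod_cast Nat.div_mul_le_self (3 * t) b
    have h3 : τ ≤ 4 * b := by
      have : (t : ℝ) ≤ (4 * b) ^ 3 := by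
        have h5 : t ≤ (4 * b) ^ 3 := by
          calc t ≤ 4 * (b + 1) ^ 3 := htb.le
            _ ≤ 4 * (2 * b) ^ 3 := by gcongr; omega
            _ ≤ (4 * b) ^ 3 := by nlinarith [Nat.zero_le (b ^ 3)]
        exact_mod_cast h5
      rw [← hτt] at this
      exact le_of_pow_le_pow_left₀ (by norm_num) (by positivity) this
    have hτpos : 0 < τ := by
      rcases hτ.lt_or_eq with h | h
      · exact h
      · exfalso
        rw [← h] at hτt
        have : (t : ℝ) ≥ 4 := by exact_mod_cast ht
        norm_num at hτt
        linarith
    have h4 : ((3 * t / b : ℕ) : ℝ) ≤ 12 * τ ^ 2 := by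
      have h5 : ((3 * t / b : ℕ) : ℝ) * τ ≤ 12 * τ ^ 2 * τ := by
        calc ((3 * t / b : ℕ) : ℝ) * τ ≤ ((3 * t / b : ℕ) : ℝ) * (4 * b) := by gcongr
          _ = 4 * (((3 * t / b : ℕ) : ℝ) * b) := by ring
          _ ≤ 4 * (3 * t) := by gcongr
          _ = 12 * τ ^ 2 * τ := by rw [← hτt]; ring
      exact le_of_mul_le_mul_right h5 hτpos
    have h6 : ((Cs p t φ σ m).card : ℝ) ≤ ((3 * t / b : ℕ) : ℝ) * (t * m) := by exact_mod_cast h1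
    have h7 : ((3 * t / b : ℕ) : ℝ) * (t * m) ≤ 12 * (τ ^ 4 * μ ^ 3) := by
      calc ((3 * t / b : ℕ) : ℝ) * (t * m) ≤ 12 * τ ^ 2 * (t * m) := by gcongr
        _ = 12 * (τ ^ 4 * μ ^ 2 * τ) := by rw [← hτt, ← hμm]; ring
        _ ≤ 12 * (τ ^ 4 * μ ^ 2 * μ) := by gcongr
        _ = _ := by ring
    linarith
  · have h1 := Cs_three p t φ hadd hne hinj σ hσ m hm
    have h2 : ((Cs p t φ σ m).card : ℝ) ≤ (t : ℝ) ^ 2 * m ^ 2 / p + p * t := by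
      rw [← mul_le_mul_iff_right₀ hp]
      refine h1.trans (le_of_eq ?_)
      field_simp
    have hbτ : (b : ℝ) ≤ τ := by
      have : (b : ℝ) ^ 3 ≤ τ ^ 3 := by
        rw [hτt]
        have : b ^ 3 ≤ t := by omega
        exact_mod_cast this
      exact le_of_pow_le_pow_left₀ (by norm_num) hτ this
    have h3 : (p : ℝ) ≤ 2 * τ ^ 4 := by
      have h5 : (p : ℝ) ≤ t * (2 * b) := by exact_mod_cast (not_le.mp hc).le
      calc (p : ℝ) ≤ t * (2 * b) := h5
        _ ≤ t * (2 * τ) := by gcongr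
        _ = 2 * τ ^ 4 := by rw [← hτt]; ring
    have h4 : (p : ℝ) * t ≤ 2 * (τ ^ 4 * μ ^ 3) := by
      calc (p : ℝ) * t ≤ 2 * τ ^ 4 * τ ^ 3 := by rw [hτt]; gcongr
        _ ≤ 2 * τ ^ 4 * μ ^ 3 := by gcongr
        _ = _ := by ring
    have h5 : 0 ≤ τ ^ 4 * μ ^ 3 := by positivity
    linarith

theorem div_sum (s : ℝ) (hs : 1 < s) : ∃ Z : ℝ, 0 < Z ∧ ∀ t : ℕ, 0 < t →
    ∑ m ∈ t.divisors, (m : ℝ) ^ s ≤ Z * (t : ℝ) ^ s := by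
  have hsum : Summable (fun n : ℕ => ((n : ℝ) ^ s)⁻¹) := Real.summable_nat_rpow_inv.mpr hs
  refine ⟨(∑' n : ℕ, ((n : ℝ) ^ s)⁻¹) + 1, ?_, ?_⟩
  · have : 0 ≤ ∑' n : ℕ, ((n : ℝ) ^ s)⁻¹ := tsum_nonneg fun n => by positivity
    linarith
  · intro t ht
    rw [← Nat.sum_div_divisors t (fun m => (m : ℝ) ^ s)]
    have h1 : ∀ g ∈ t.divisors, (((t / g : ℕ) : ℝ)) ^ s = (t : ℝ) ^ s * ((g : ℝ) ^ s)⁻¹ := by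
      intro g hg
      have hd := Nat.dvd_of_mem_divisors hg
      have hg0 : (g : ℝ) ≠ 0 := by
        have := Nat.pos_of_mem_divisors hg
        positivity
      rw [Nat.cast_div hd hg0, Real.div_rpow (by positivity) (by positivity), div_eq_mul_inv]
    rw [Finset.sum_congr rfl h1, ← Finset.mul_sum, mul_comm]
    gcongr
    have := hsum.sum_le_tsum t.divisors (fun n _ => by positivity)
    linarith
theorem weighted (p t : ℕ) [Fact p.Prime] [NeZero t] (φ : ZMod t → ZMod p)
    (hadd : ∀ a b, φ (a + b) = φ a * φ b) (hne : ∀ a, φ a ≠ 0) (hinj : Function.Injective φ)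
    (σ : ZMod p) (hσ : σ = 1 ∨ σ = -1) (ht : 4 ≤ t) (Z1 Z2 : ℝ)
    (hZ1 : ∑ m ∈ t.divisors, (m : ℝ) ^ (5/3 : ℝ) ≤ Z1 * (t : ℝ) ^ (5/3 : ℝ))
    (hZ2 : ∑ m ∈ t.divisors, (m : ℝ) ^ (7/6 : ℝ) ≤ Z2 * (t : ℝ) ^ (7/6 : ℝ))
    (N : Finset (ZMod t × ZMod t × ZMod t × ZMod t))
    (J : ZMod t × ZMod t × ZMod t × ZMod t → ZMod t × ZMod t × ZMod t × ZMod t)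
    (hJ : Function.Injective J)
    (hN : ∀ s ∈ N, φ (J s).1 * (φ (J s).2.1 + σ) = φ (J s).2.2.1 * (φ (J s).2.2.2 + σ) ∧
      φ (J s).2.1 + σ ≠ 0) :
    ∑ s ∈ N, (t : ℝ) * (addOrderOf ((J s).2.1, (J s).2.2.2) : ℝ) ^ (-(1/3) : ℝ) ≤
      Z1 * ((t : ℝ) ^ (14/3 : ℝ) / p) + 12 * Z2 * (t : ℝ) ^ (7/2 : ℝ) := by
  classical
  have htpos : (0:ℝ) < t := by exact_mod_cast (by omega : 0 < t)
  have hp : (0:ℝ) < p := by exact_mod_cast (Fact.out : p.Prime).pos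
  have hmaps : ∀ s ∈ N, addOrderOf ((J s).2.1, (J s).2.2.2) ∈ t.divisors := by
    intro s _
    rw [Nat.mem_divisors]
    refine ⟨addOrderOf_dvd_of_nsmul_eq_zero ?_, by omega⟩
    ext <;> simp
  rw [← Finset.sum_fiberwise_of_maps_to hmaps]
  have hfib : ∀ m ∈ t.divisors, ∑ s ∈ N.filter (fun s => addOrderOf ((J s).2.1, (J s).2.2.2) = m),
      (t : ℝ) * (addOrderOf ((J s).2.1, (J s).2.2.2) : ℝ) ^ (-(1/3) : ℝ) ≤
      (t : ℝ) ^ 3 / p * (m : ℝ) ^ (5/3 : ℝ) + 12 * (t : ℝ) ^ (7/3 : ℝ) * (m : ℝ) ^ (7/6 : ℝ) := by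
    intro m hm
    have hmpos : 0 < m := Nat.pos_of_mem_divisors hm
    have hm' : (0:ℝ) < m := by exact_mod_cast hmpos
    have h1 : ∑ s ∈ N.filter (fun s => addOrderOf ((J s).2.1, (J s).2.2.2) = m),
      (t : ℝ) * (addOrderOf ((J s).2.1, (J s).2.2.2) : ℝ) ^ (-(1/3) : ℝ)
        = ((N.filter (fun s => addOrderOf ((J s).2.1, (J s).2.2.2) = m)).card : ℝ)
          * (t * (m : ℝ) ^ (-(1/3) : ℝ)) := by
      rw [← nsmul_eq_mul, ← Finset.sum_const]
      refine Finset.sum_congr rfl fun s hs => ?_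
      rw [(Finset.mem_filter.mp hs).2]
    have h2 : (N.filter (fun s => addOrderOf ((J s).2.1, (J s).2.2.2) = m)).card ≤ (Cs p t φ σ m).card := by
      refine Finset.card_le_card_of_injOn J ?_ hJ.injOn
      intro s hs
      obtain ⟨hs1, hs2⟩ := Finset.mem_filter.mp (Finset.mem_coe.mp hs)
      have h3 := hN s hs1
      have h4 := addOrderOf_nsmul_eq_zero ((J s).2.1, (J s).2.2.2)
      rw [hs2] at h4
      have h5 := congrArg Prod.fst h4
      have h6 := congrArg Prod.snd h4
      simp only [Prod.smul_mk, nsmul_eq_mul, Prod.fst_zero, Prod.snd_zero] at h5 h6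
      simp only [Cs, Finset.mem_coe, Finset.mem_filter, Finset.mem_univ, true_and]
      exact ⟨h5, h6, h3.1, h3.2⟩
    have h3 := Cs_bound p t φ hadd hne hinj σ hσ m hmpos ht ((t : ℝ) ^ (1/3 : ℝ)) ((m : ℝ) ^ (1/2 : ℝ))
      (by positivity) (by positivity)
      (by rw [← Real.rpow_natCast, ← Real.rpow_mul (by positivity)]; norm_num)
      (by rw [← Real.rpow_natCast, ← Real.rpow_mul (by positivity)]; norm_num)
    have h2' : ((N.filter (fun s => addOrderOf ((J s).2.1, (J s).2.2.2) = m)).card : ℝ)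
        ≤ ((Cs p t φ σ m).card : ℝ) := by exact_mod_cast h2
    rw [h1]
    have h4 := mul_le_mul_of_nonneg_right (h2'.trans h3)
      (show 0 ≤ (t : ℝ) * (m : ℝ) ^ (-(1/3) : ℝ) by positivity)
    refine h4.trans (le_of_eq ?_)
    have e1 : (m : ℝ) ^ (5/3 : ℝ) = (m : ℝ) ^ 2 * (m : ℝ) ^ (-(1/3) : ℝ) := by
      rw [← Real.rpow_natCast, ← Real.rpow_add hm']; norm_num
    have e2 : (m : ℝ) ^ (7/6 : ℝ) = ((m : ℝ) ^ (1/2 : ℝ)) ^ 3 * (m : ℝ) ^ (-(1/3) : ℝ) := by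
      rw [← Real.rpow_natCast, ← Real.rpow_mul hm'.le, ← Real.rpow_add hm']; norm_num
    have e3 : (t : ℝ) ^ (7/3 : ℝ) = ((t : ℝ) ^ (1/3 : ℝ)) ^ 4 * t := by
      rw [← Real.rpow_natCast, ← Real.rpow_mul htpos.le, ← Real.rpow_add_one htpos.ne']; norm_num
    rw [e1, e2, e3]
    ring
  refine (Finset.sum_le_sum hfib).trans ?_
  rw [Finset.sum_add_distrib, ← Finset.mul_sum, ← Finset.mul_sum]
  have e1 : (t : ℝ) ^ (14/3 : ℝ) = (t : ℝ) ^ 3 * (t : ℝ) ^ (5/3 : ℝ) := by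
    rw [← Real.rpow_natCast, ← Real.rpow_add htpos]; norm_num
  have e2 : (t : ℝ) ^ (7/2 : ℝ) = (t : ℝ) ^ (7/3 : ℝ) * (t : ℝ) ^ (7/6 : ℝ) := by
    rw [← Real.rpow_add htpos]; norm_num
  rw [e1, e2]
  have f1 := mul_le_mul_of_nonneg_left hZ1 (show 0 ≤ (t : ℝ) ^ 3 / p by positivity)
  have f2 := mul_le_mul_of_nonneg_left hZ2 (show 0 ≤ 12 * (t : ℝ) ^ (7/3 : ℝ) by positivity)
  calc _ ≤ _ := add_le_add f1 f2
    _ = _ := by ring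

theorem K_real (K R t : ℕ) (hR : 0 < R) (h : K ^ 3 * R ≤ 64 * t ^ 3) :
    (K : ℝ) ≤ 4 * ((t : ℝ) * (R : ℝ) ^ (-(1/3) : ℝ)) := by
  have hR' : (0:ℝ) < R := by exact_mod_cast hR
  have h' : (K : ℝ) ^ 3 * R ≤ 64 * (t : ℝ) ^ 3 := by exact_mod_cast h
  have e : ((R : ℝ) ^ (-(1/3) : ℝ)) ^ 3 * R = 1 := by
    rw [← Real.rpow_natCast, ← Real.rpow_mul hR'.le, ← Real.rpow_add_one hR'.ne']; norm_num
  refine le_of_pow_le_pow_left₀ (n := 3) (by norm_num) (by positivity) ?_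
  refine le_of_mul_le_mul_right (h'.trans (le_of_eq ?_)) hR'
  calc 64 * (t : ℝ) ^ 3 = 64 * (t : ℝ) ^ 3 * 1 := by ring
    _ = 64 * (t : ℝ) ^ 3 * (((R : ℝ) ^ (-(1/3) : ℝ)) ^ 3 * R) := by rw [e]
    _ = _ := by ring

noncomputable def Kset (p t : ℕ) [NeZero t] (φ : ZMod t → ZMod p)
    (s : ZMod t × ZMod t × ZMod t × ZMod t) : Finset (ZMod t) :=
  Finset.univ.filter (fun y => φ (s.1 * y) + φ (s.2.1 * y) = φ (s.2.2.1 * y) + φ (s.2.2.2 * y))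

theorem Kset_le (p t : ℕ) [Fact p.Prime] [NeZero t] (φ : ZMod t → ZMod p)
    (hadd : ∀ a b, φ (a + b) = φ a * φ b) (hne : ∀ a, φ a ≠ 0) (hinj : Function.Injective φ)
    (x1 x2 x3 x4 : ZMod t) :
    ((Kset p t φ (x1, x2, x3, x4)).card : ℝ) ≤
      4 * ((t : ℝ) * (addOrderOf (x1 - x3, x4 - x2) : ℝ) ^ (-(1/3) : ℝ))
      + 4 * ((t : ℝ) * (addOrderOf (x1 - x4, x3 - x2) : ℝ) ^ (-(1/3) : ℝ))
      + 4 * ((t : ℝ) * (addOrderOf (x2 - x1, x4 - x3) : ℝ) ^ (-(1/3) : ℝ)) := by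
  set o1 := addOrderOf (x1 - x3, x4 - x2) with h1
  set o2 := addOrderOf (x1 - x4, x3 - x2) with h2
  set o3 := addOrderOf (x2 - x1, x4 - x3) with h3
  have p1 : 0 < o1 := addOrderOf_pos _
  have p2 : 0 < o2 := addOrderOf_pos _
  have p3 : 0 < o3 := addOrderOf_pos _
  have aux : ∀ (u v : ZMod t) (r : ℕ), 0 < r → r < addOrderOf (u, v) → ¬ ((r : ZMod t) * u = 0 ∧ (r : ZMod t) * v = 0) := by
    intro u v r hr0 hr h
    have : r • (u, v) = 0 := by
      simp only [Prod.smul_mk, nsmul_eq_mul, h.1, h.2]; rfl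
    exact absurd (Nat.le_of_dvd hr0 (addOrderOf_dvd_of_nsmul_eq_zero this)) (by omega)
  have hK := K_bound t φ hadd hne hinj x1 x2 x3 x4 (min o1 (min o2 o3))
    (fun r h0 hr h => aux (x1 - x3) (x4 - x2) r h0 (by omega)
      ⟨by linear_combination h.1, by linear_combination -h.2⟩)
    (fun r h0 hr h => aux (x1 - x4) (x3 - x2) r h0 (by omega)
      ⟨by linear_combination h.1, by linear_combination -h.2⟩)
    (fun r h0 hr h => aux (x2 - x1) (x4 - x3) r h0 (by omega)
      ⟨by linear_combination -h.1, by linear_combination -h.2⟩)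
  have hK' := K_real _ _ t (by omega) hK
  have q1 : 0 ≤ 4 * ((t : ℝ) * (o1 : ℝ) ^ (-(1/3) : ℝ)) := by positivity
  have q2 : 0 ≤ 4 * ((t : ℝ) * (o2 : ℝ) ^ (-(1/3) : ℝ)) := by positivity
  have q3 : 0 ≤ 4 * ((t : ℝ) * (o3 : ℝ) ^ (-(1/3) : ℝ)) := by positivity
  have hmin : min o1 (min o2 o3) = o1 ∨ min o1 (min o2 o3) = o2 ∨ min o1 (min o2 o3) = o3 := by omega
  change (((Finset.univ.filter (fun y : ZMod t => φ (x1 * y) + φ (x2 * y) = φ (x3 * y) + φ (x4 * y))).card : ℕ) : ℝ) ≤ _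
  rcases hmin with h | h | h <;> rw [h] at hK' <;> linarith

noncomputable def Sol (p t : ℕ) [NeZero t] (φ : ZMod t → ZMod p) :
    Finset (ZMod t × ZMod t × ZMod t × ZMod t) :=
  Finset.univ.filter (fun s => φ s.1 + φ s.2.1 = φ s.2.2.1 + φ s.2.2.2)

def Deg (p t : ℕ) (φ : ZMod t → ZMod p) (s : ZMod t × ZMod t × ZMod t × ZMod t) : Prop :=
  s.1 = s.2.2.1 ∨ s.1 = s.2.2.2 ∨ φ s.1 + φ s.2.1 = 0

open Classical in
theorem deg_card (p t : ℕ) [Fact p.Prime] [NeZero t] (φ : ZMod t → ZMod p)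
    (hinj : Function.Injective φ) :
    ((Sol p t φ).filter (fun s => Deg p t φ s)).card ≤ 3 * t ^ 2 := by
  have hc : ((Finset.univ : Finset (ZMod t × ZMod t))).card = t ^ 2 := by
    rw [Finset.card_univ, Fintype.card_prod, ZMod.card, pow_two]
  have h1 : ((Sol p t φ).filter (fun s => s.1 = s.2.2.1)).card ≤ t ^ 2 := by
    rw [← hc]
    refine Finset.card_le_card_of_injOn (fun s => (s.1, s.2.1)) (by simp) ?_
    rintro ⟨a, b, c, d⟩ hs ⟨a', b', c', d'⟩ hs' h
    simp only [Sol, Finset.mem_coe, Finset.mem_filter, Finset.mem_univ, true_and, Prod.mk.injEq] at hs hs' h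
    obtain ⟨rfl, rfl⟩ := h
    obtain ⟨hs, rfl⟩ := hs
    obtain ⟨hs', rfl⟩ := hs'
    have : d = d' := hinj (add_left_cancel (hs.symm.trans hs'))
    rw [this]
  have h2 : ((Sol p t φ).filter (fun s => s.1 = s.2.2.2)).card ≤ t ^ 2 := by
    rw [← hc]
    refine Finset.card_le_card_of_injOn (fun s => (s.1, s.2.1)) (by simp) ?_
    rintro ⟨a, b, c, d⟩ hs ⟨a', b', c', d'⟩ hs' h
    simp only [Sol, Finset.mem_coe, Finset.mem_filter, Finset.mem_univ, true_and, Prod.mk.injEq] at hs hs' h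
    obtain ⟨rfl, rfl⟩ := h
    obtain ⟨hs, rfl⟩ := hs
    obtain ⟨hs', rfl⟩ := hs'
    have : c = c' := hinj (add_right_cancel (hs.symm.trans hs'))
    rw [this]
  have h3 : ((Sol p t φ).filter (fun s => φ s.1 + φ s.2.1 = 0)).card ≤ t ^ 2 := by
    rw [← hc]
    refine Finset.card_le_card_of_injOn (fun s => (s.1, s.2.2.1)) (by simp) ?_
    rintro ⟨a, b, c, d⟩ hs ⟨a', b', c', d'⟩ hs' h
    simp only [Sol, Finset.mem_coe, Finset.mem_filter, Finset.mem_univ, true_and, Prod.mk.injEq] at hs hs' h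
    obtain ⟨rfl, rfl⟩ := h
    have e1 : b = b' := hinj (add_left_cancel (hs.2.trans hs'.2.symm))
    have e2 : d = d' := hinj (add_left_cancel ((hs.1.symm.trans hs.2).trans (hs'.1.symm.trans hs'.2).symm))
    rw [e1, e2]
  have hsub : (Sol p t φ).filter (fun s => Deg p t φ s) ⊆
      (Sol p t φ).filter (fun s => s.1 = s.2.2.1) ∪ ((Sol p t φ).filter (fun s => s.1 = s.2.2.2) ∪
        (Sol p t φ).filter (fun s => φ s.1 + φ s.2.1 = 0)) := by
    intro s hs
    obtain ⟨h1, h2⟩ := Finset.mem_filter.mp hs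
    simp only [Finset.mem_union, Finset.mem_filter]
    rcases h2 with h2 | h2 | h2
    exacts [Or.inl ⟨h1, h2⟩, Or.inr (Or.inl ⟨h1, h2⟩), Or.inr (Or.inr ⟨h1, h2⟩)]
  have h4 := (Finset.card_le_card hsub).trans ((Finset.card_union_le _ _).trans
    (Nat.add_le_add_left (Finset.card_union_le _ _) _))
  omega

theorem main_bound (p t : ℕ) [Fact p.Prime] [NeZero t] (φ : ZMod t → ZMod p)
    (hadd : ∀ a b, φ (a + b) = φ a * φ b) (hne : ∀ a, φ a ≠ 0) (hinj : Function.Injective φ)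
    (ht : 4 ≤ t) (Z1 Z2 : ℝ)
    (hZ1 : ∑ m ∈ t.divisors, (m : ℝ) ^ (5/3 : ℝ) ≤ Z1 * (t : ℝ) ^ (5/3 : ℝ))
    (hZ2 : ∑ m ∈ t.divisors, (m : ℝ) ^ (7/6 : ℝ) ≤ Z2 * (t : ℝ) ^ (7/6 : ℝ)) :
    ∑ s ∈ Sol p t φ, ((Kset p t φ s).card : ℝ) ≤
      12 * (Z1 * ((t : ℝ) ^ (14/3 : ℝ) / p) + 12 * Z2 * (t : ℝ) ^ (7/2 : ℝ)) + 3 * (t : ℝ) ^ (7/2 : ℝ) := by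
  classical
  have hφ0 : φ 0 = 1 := by simpa using phi_nsmul φ hadd hne 0 0
  rw [← Finset.sum_filter_add_sum_filter_not (Sol p t φ) (fun s => Deg p t φ s)]
  have hdeg : ∑ s ∈ (Sol p t φ).filter (fun s => Deg p t φ s), ((Kset p t φ s).card : ℝ) ≤ 3 * (t : ℝ) ^ (7/2 : ℝ) := by
    have h1 : ∀ s, ((Kset p t φ s).card : ℝ) ≤ t := by
      intro s
      have : (Kset p t φ s).card ≤ t := by
        calc _ ≤ (Finset.univ : Finset (ZMod t)).card := Finset.card_le_univ _
          _ = t := by rw [Finset.card_univ, ZMod.card]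
      exact_mod_cast this
    have h2 : (((Sol p t φ).filter (fun s => Deg p t φ s)).card : ℝ) ≤ 3 * (t : ℝ) ^ 2 := by
      exact_mod_cast deg_card p t φ hinj
    calc _ ≤ ∑ s ∈ (Sol p t φ).filter (fun s => Deg p t φ s), (t : ℝ) := Finset.sum_le_sum fun s _ => h1 s
      _ = (((Sol p t φ).filter (fun s => Deg p t φ s)).card : ℝ) * t := by rw [Finset.sum_const, nsmul_eq_mul]
      _ ≤ 3 * (t : ℝ) ^ 2 * t := by gcongr
      _ = 3 * (t : ℝ) ^ (3 : ℝ) := by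
        rw [show (3 : ℝ) = ((3 : ℕ) : ℝ) by norm_num, Real.rpow_natCast]; ring
      _ ≤ 3 * (t : ℝ) ^ (7/2 : ℝ) := by
        gcongr
        · exact_mod_cast (by omega : 1 ≤ t)
        · norm_num
  set N := (Sol p t φ).filter (fun s => ¬ Deg p t φ s) with hN
  have hmem : ∀ s ∈ N, φ s.1 + φ s.2.1 = φ s.2.2.1 + φ s.2.2.2 ∧ s.1 ≠ s.2.2.1 ∧ s.1 ≠ s.2.2.2 ∧
      φ s.1 + φ s.2.1 ≠ 0 := by
    intro s hs
    simp only [hN, Sol, Deg, Finset.mem_filter, Finset.mem_univ, true_and, not_or] at hs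
    exact ⟨hs.1, hs.2.1, hs.2.2.1, hs.2.2.2⟩
  have hsubφ : ∀ x y : ZMod t, φ y * φ (x - y) = φ x := by
    intro x y
    rw [← hadd]; congr 1; ring
  have hne1 : ∀ x y : ZMod t, x ≠ y → φ (x - y) + (-1) ≠ 0 := by
    intro x y hxy h
    have h1 : φ (x - y) = φ 0 := by rw [hφ0]; linear_combination h
    exact hxy (sub_eq_zero.mp (hinj h1))
  have w1 := weighted p t φ hadd hne hinj (-1) (Or.inr rfl) ht Z1 Z2 hZ1 hZ2 N
    (fun s => (s.2.2.1, s.1 - s.2.2.1, s.2.1, s.2.2.2 - s.2.1))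
    (by
      rintro ⟨a, b, c, d⟩ ⟨a', b', c', d'⟩ h
      simp only [Prod.mk.injEq] at h ⊢
      obtain ⟨rfl, h1, rfl, h2⟩ := h
      exact ⟨sub_left_injective h1, rfl, rfl, sub_left_injective h2⟩)
    (by
      rintro ⟨a, b, c, d⟩ hs
      obtain ⟨h1, h2, h3, h4⟩ := hmem _ hs
      refine ⟨?_, hne1 _ _ h2⟩
      simp only [] at h1 ⊢
      linear_combination hsubφ a c - hsubφ d b + h1)
  have w2 := weighted p t φ hadd hne hinj (-1) (Or.inr rfl) ht Z1 Z2 hZ1 hZ2 N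
    (fun s => (s.2.2.2, s.1 - s.2.2.2, s.2.1, s.2.2.1 - s.2.1))
    (by
      rintro ⟨a, b, c, d⟩ ⟨a', b', c', d'⟩ h
      simp only [Prod.mk.injEq] at h ⊢
      obtain ⟨rfl, h1, rfl, h2⟩ := h
      exact ⟨sub_left_injective h1, rfl, sub_left_injective h2, rfl⟩)
    (by
      rintro ⟨a, b, c, d⟩ hs
      obtain ⟨h1, h2, h3, h4⟩ := hmem _ hs
      refine ⟨?_, hne1 _ _ h3⟩
      simp only [] at h1 ⊢
      linear_combination hsubφ a d - hsubφ c b + h1)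
  have w3 := weighted p t φ hadd hne hinj 1 (Or.inl rfl) ht Z1 Z2 hZ1 hZ2 N
    (fun s => (s.1, s.2.1 - s.1, s.2.2.1, s.2.2.2 - s.2.2.1))
    (by
      rintro ⟨a, b, c, d⟩ ⟨a', b', c', d'⟩ h
      simp only [Prod.mk.injEq] at h ⊢
      obtain ⟨rfl, h1, rfl, h2⟩ := h
      exact ⟨rfl, sub_left_injective h1, rfl, sub_left_injective h2⟩)
    (by
      rintro ⟨a, b, c, d⟩ hs
      obtain ⟨h1, h2, h3, h4⟩ := hmem _ hs
      refine ⟨?_, ?_⟩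
      · simp only [] at h1 ⊢
        linear_combination hsubφ b a - hsubφ d c + h1
      · intro h
        apply h4
        simp only [] at h ⊢
        linear_combination φ a * h - hsubφ b a)
  have hnd : ∑ s ∈ N, ((Kset p t φ s).card : ℝ) ≤
      12 * (Z1 * ((t : ℝ) ^ (14/3 : ℝ) / p) + 12 * Z2 * (t : ℝ) ^ (7/2 : ℝ)) := by
    refine (Finset.sum_le_sum fun s _ => Kset_le p t φ hadd hne hinj s.1 s.2.1 s.2.2.1 s.2.2.2).trans ?_
    rw [Finset.sum_add_distrib, Finset.sum_add_distrib]
    have v1 := mul_le_mul_of_nonneg_left w1 (by norm_num : (0:ℝ) ≤ 4)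
    have v2 := mul_le_mul_of_nonneg_left w2 (by norm_num : (0:ℝ) ≤ 4)
    have v3 := mul_le_mul_of_nonneg_left w3 (by norm_num : (0:ℝ) ≤ 4)
    rw [Finset.mul_sum] at v1 v2 v3
    simp only [mul_assoc] at v1 v2 v3 ⊢
    linarith
  linarith

theorem stmt4 : ∃ C > (0:ℝ), ∀ (p t : ℕ) (l : ℤ),
    p.Prime → orderOf (l : ZMod p) = t →
    ((((Finset.Icc 1 t) ×ˢ (Finset.Icc 1 t) ×ˢ (Finset.Icc 1 t) ×ˢ (Finset.Icc 1 t) ×ˢ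
        (Finset.Icc 1 t)).filter (fun q : ℕ × ℕ × ℕ × ℕ × ℕ =>
        (l : ZMod p) ^ q.1 + (l : ZMod p) ^ q.2.1
          = (l : ZMod p) ^ q.2.2.1 + (l : ZMod p) ^ q.2.2.2.1 ∧
        (l : ZMod p) ^ (q.1 * q.2.2.2.2) + (l : ZMod p) ^ (q.2.1 * q.2.2.2.2)
          = (l : ZMod p) ^ (q.2.2.1 * q.2.2.2.2) + (l : ZMod p) ^ (q.2.2.2.1 * q.2.2.2.2))).card
      : ℝ) ≤ C * ((t : ℝ) ^ ((14:ℝ)/3) / p + (t : ℝ) ^ ((7:ℝ)/2)) := by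
  obtain ⟨Z1, hZ1pos, hZ1⟩ := div_sum (5/3) (by norm_num)
  obtain ⟨Z2, hZ2pos, hZ2⟩ := div_sum (7/6) (by norm_num)
  refine ⟨12 * Z1 + 144 * Z2 + 35, by positivity, ?_⟩
  intro p t l hp hord
  haveI : Fact p.Prime := ⟨hp⟩
  set S := (((Finset.Icc 1 t) ×ˢ (Finset.Icc 1 t) ×ˢ (Finset.Icc 1 t) ×ˢ (Finset.Icc 1 t) ×ˢ
        (Finset.Icc 1 t)).filter (fun q : ℕ × ℕ × ℕ × ℕ × ℕ =>
        (l : ZMod p) ^ q.1 + (l : ZMod p) ^ q.2.1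
          = (l : ZMod p) ^ q.2.2.1 + (l : ZMod p) ^ q.2.2.2.1 ∧
        (l : ZMod p) ^ (q.1 * q.2.2.2.2) + (l : ZMod p) ^ (q.2.1 * q.2.2.2.2)
          = (l : ZMod p) ^ (q.2.2.1 * q.2.2.2.2) + (l : ZMod p) ^ (q.2.2.2.1 * q.2.2.2.2))) with hS
  set a : ℝ := (t : ℝ) ^ ((14:ℝ)/3) / p with ha
  set b : ℝ := (t : ℝ) ^ ((7:ℝ)/2) with hb
  have ha0 : 0 ≤ a := by positivity
  have hb0 : 0 ≤ b := by positivity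
  rcases Nat.lt_or_ge t 4 with ht | ht
  · have h1 : S.card ≤ t ^ 5 := by
      refine (Finset.card_filter_le _ _).trans (le_of_eq ?_)
      simp only [Finset.card_product, Nat.card_Icc]
      simp; ring
    have h2 : (t : ℝ) ^ 5 ≤ 9 * b := by
      rcases Nat.eq_zero_or_pos t with h0 | h0
      · rw [h0]; simp; exact hb0
      · have h3 : (t : ℝ) ^ (3 : ℝ) ≤ b := by
          rw [hb]
          apply Real.rpow_le_rpow_of_exponent_le
          · exact_mod_cast h0
          · norm_num
        rw [show (3 : ℝ) = ((3 : ℕ) : ℝ) by norm_num, Real.rpow_natCast] at h3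
        have h4 : (t : ℝ) ≤ 3 := by exact_mod_cast (by omega : t ≤ 3)
        calc (t : ℝ) ^ 5 = (t : ℝ) ^ 2 * (t : ℝ) ^ 3 := by ring
          _ ≤ 3 ^ 2 * b := by gcongr
          _ = 9 * b := by norm_num
    have h3 : (S.card : ℝ) ≤ (t : ℝ) ^ 5 := by exact_mod_cast h1
    nlinarith [mul_nonneg hZ1pos.le ha0, mul_nonneg hZ1pos.le hb0, mul_nonneg hZ2pos.le ha0, mul_nonneg hZ2pos.le hb0]
  haveI : NeZero t := ⟨by omega⟩
  set L : ZMod p := (l : ZMod p) with hL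
  have hL1 : L ^ t = 1 := by rw [← hord]; exact pow_orderOf_eq_one L
  have hL0 : L ≠ 0 := by
    intro h
    rw [h, zero_pow (by omega)] at hL1
    exact zero_ne_one hL1
  let φ : ZMod t → ZMod p := fun k => L ^ k.val
  have hcast : ∀ n : ℕ, φ (n : ZMod t) = L ^ n := by
    intro n
    simp only [φ, ZMod.val_natCast]
    rw [← hord, pow_mod_orderOf]
  have hadd : ∀ x y, φ (x + y) = φ x * φ y := by
    intro x y
    have : x + y = ((x.val + y.val : ℕ) : ZMod t) := by simp
    rw [this, hcast, pow_add]
  have hne : ∀ x, φ x ≠ 0 := fun x => pow_ne_zero _ hL0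
  have hinj : Function.Injective φ := by
    intro x y h
    have := pow_injOn_Iio_orderOf (x := L) (by rw [hord]; exact ZMod.val_lt x)
      (by rw [hord]; exact ZMod.val_lt y) h
    exact ZMod.val_injective t this
  have hmain := main_bound p t φ hadd hne hinj ht Z1 Z2 (hZ1 t (by omega)) (hZ2 t (by omega))
  have hcard : S.card ≤ ((Sol p t φ).sigma (fun s => Kset p t φ s)).card := by
    refine Finset.card_le_card_of_injOn
      (fun q => ⟨((q.1 : ZMod t), (q.2.1 : ZMod t), (q.2.2.1 : ZMod t), (q.2.2.2.1 : ZMod t)), (q.2.2.2.2 : ZMod t)⟩) ?_ ?_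
    · rintro ⟨x1, x2, x3, x4, y⟩ hq
      simp only [hS, Finset.mem_coe, Finset.mem_filter] at hq
      simp only [Finset.mem_coe, Finset.mem_sigma, Sol, Kset, Finset.mem_filter, Finset.mem_univ, true_and,
        ← Nat.cast_mul, hcast]
      exact hq.2
    · rintro ⟨x1, x2, x3, x4, y⟩ hq ⟨x1', x2', x3', x4', y'⟩ hq' h
      simp only [hS, Finset.mem_coe, Finset.mem_filter, Finset.mem_product, Finset.mem_Icc] at hq hq'
      have hIcc : ∀ m n : ℕ, 1 ≤ m ∧ m ≤ t → 1 ≤ n ∧ n ≤ t → (m : ZMod t) = n → m = n := by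
        intro m n hm hn hmn
        rw [ZMod.natCast_eq_natCast_iff] at hmn
        have h1 : (m - 1) + 1 ≡ (n - 1) + 1 [MOD t] := by
          rw [Nat.sub_add_cancel hm.1, Nat.sub_add_cancel hn.1]; exact hmn
        have h2 := Nat.ModEq.add_right_cancel' 1 h1
        have h3 := Nat.ModEq.eq_of_lt_of_lt h2 (by omega) (by omega)
        omega
      simp only [Sigma.mk.injEq, Prod.mk.injEq, heq_eq_eq] at h
      obtain ⟨⟨h1, h2, h3, h4⟩, h5⟩ := h
      obtain ⟨⟨a1, a2, a3, a4, a5⟩, -⟩ := hq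
      obtain ⟨⟨b1, b2, b3, b4, b5⟩, -⟩ := hq'
      rw [hIcc _ _ a1 b1 h1, hIcc _ _ a2 b2 h2, hIcc _ _ a3 b3 h3, hIcc _ _ a4 b4 h4, hIcc _ _ a5 b5 h5]
  rw [Finset.card_sigma] at hcard
  have hcard' : (S.card : ℝ) ≤ ∑ s ∈ Sol p t φ, ((Kset p t φ s).card : ℝ) := by exact_mod_cast hcard
  have := hcard'.trans hmain
  nlinarith [mul_nonneg hZ1pos.le ha0, mul_nonneg hZ1pos.le hb0, mul_nonneg hZ2pos.le ha0, mul_nonneg hZ2pos.le hb0]
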